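/- Let x(t,ε) be a C² family with ∂_t x = ξ_0(x,t) + η_p ξ_p(x) and ∂_ε x = ω_p ξ_p(x), and let f(η, x, t) be a C² function such that along ε = 0 the Chetaev condition (∂f/∂η_p)(η(t,0), x(t,0), t)·ω_p(t,0) = 0 holds for all t. Then the synchronous variation δf := ∂_ε[ f(η(t,ε), x(t,ε), t) ]|_{ε=0} is given by δf = [ X_p f + (C_{0p}^r + C_{qp}^r η_q) ∂f/∂η_r − d/dt(∂f/∂η_p) ] ω_p, where d/dt denotes the total derivative along the motion t ↦ x(t,0) and all quantities are evaluated at ε = 0. -/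

import Mathlib

open scoped BigOperators

namespace NNH

/-- Full index type for `p, q, r = 1,…,n`: `Sum.inl i` are the independent
indices `i, j, k = 1,…,m` and `Sum.inr α` the dependent ones
`α, β = m+1,…,n` (so `n = m + κ`). -/
abbrev Idx (m κ : ℕ) := Fin m ⊕ Fin κ

variable {m κ : ℕ}

/-- Partial derivative of `f : (ι → ℝ) → ℝ` in the `i`-th coordinate at `v`. -/
noncomputable def pd {ι : Type*} [DecidableEq ι] (f : (ι → ℝ) → ℝ) (i : ι) (v : ι → ℝ) : ℝ :=
  deriv (fun s => f (Function.update v i s)) (v i)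

/-- The operator `X_p G = ξ_p^q ∂G/∂x_q` (differentiation in `x` only). -/
noncomputable def Xp (ξ : Idx m κ → (Idx m κ → ℝ) → Idx m κ → ℝ) (p : Idx m κ)
    (G : (Idx m κ → ℝ) → ℝ → ℝ) : (Idx m κ → ℝ) → ℝ → ℝ :=
  fun x t => ∑ q, ξ p x q * pd (fun v => G v t) q x

/-- The operator `X₀ G = ∂G/∂t + ξ₀^q ∂G/∂x_q`. -/
noncomputable def X0 (ξ0 : (Idx m κ → ℝ) → ℝ → Idx m κ → ℝ)
    (G : (Idx m κ → ℝ) → ℝ → ℝ) : (Idx m κ → ℝ) → ℝ → ℝ :=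
  fun x t => deriv (fun s => G x s) t + ∑ q, ξ0 x t q * pd (fun v => G v t) q x

/-- `∂f/∂η_p` for a function `f(η, x, t)`. -/
noncomputable def pEta (f : (Idx m κ → ℝ) → (Idx m κ → ℝ) → ℝ → ℝ) (p : Idx m κ)
    (η x : Idx m κ → ℝ) (t : ℝ) : ℝ :=
  pd (fun w => f w x t) p η

/-- `∂φ_α/∂η_j`. -/
noncomputable def dphi (φ : Fin κ → (Fin m → ℝ) → (Idx m κ → ℝ) → ℝ → ℝ)
    (α : Fin κ) (j : Fin m) (v : Fin m → ℝ) (x : Idx m κ → ℝ) (t : ℝ) : ℝ :=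
  pd (fun w => φ α w x t) j v

/-- The full vector of Poincaré parameters obtained from the independent ones
`v = (η_1,…,η_m)` by imposing the constraints `η_α = φ_α(v, x, t)`. -/
noncomputable def etaExt (φ : Fin κ → (Fin m → ℝ) → (Idx m κ → ℝ) → ℝ → ℝ)
    (v : Fin m → ℝ) (x : Idx m κ → ℝ) (t : ℝ) : Idx m κ → ℝ :=
  Sum.elim v fun α => φ α v x t

/-- `K_{0j}^s := C_{0j}^s + C_{0β}^s ∂φ_β/∂η_j`. -/
noncomputable def K0 (C0 : Idx m κ → Idx m κ → (Idx m κ → ℝ) → ℝ → ℝ)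
    (φ : Fin κ → (Fin m → ℝ) → (Idx m κ → ℝ) → ℝ → ℝ)
    (j : Fin m) (s : Idx m κ) (v : Fin m → ℝ) (x : Idx m κ → ℝ) (t : ℝ) : ℝ :=
  C0 (.inl j) s x t + ∑ β, C0 (.inr β) s x t * dphi φ β j v x t

/-- `K_{qj}^s := C_{qj}^s + C_{qβ}^s ∂φ_β/∂η_j`. -/
noncomputable def Kq (C : Idx m κ → Idx m κ → Idx m κ → (Idx m κ → ℝ) → ℝ → ℝ)
    (φ : Fin κ → (Fin m → ℝ) → (Idx m κ → ℝ) → ℝ → ℝ)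
    (q : Idx m κ) (j : Fin m) (s : Idx m κ) (v : Fin m → ℝ) (x : Idx m κ → ℝ) (t : ℝ) : ℝ :=
  C q (.inl j) s x t + ∑ β, C q (.inr β) s x t * dphi φ β j v x t

/-- `X*_j G := X_j G + (∂φ_β/∂η_j) X_β G`. -/
noncomputable def Xstar (ξ : Idx m κ → (Idx m κ → ℝ) → Idx m κ → ℝ)
    (φ : Fin κ → (Fin m → ℝ) → (Idx m κ → ℝ) → ℝ → ℝ)
    (j : Fin m) (G : (Idx m κ → ℝ) → ℝ → ℝ)
    (v : Fin m → ℝ) (x : Idx m κ → ℝ) (t : ℝ) : ℝ :=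
  Xp ξ (.inl j) G x t + ∑ β, dphi φ β j v x t * Xp ξ (.inr β) G x t

/-- The reduced Lagrangian `L*(η_1,…,η_m, x, t) = L(η_i, φ_α(η_i,x,t), x, t)`. -/
noncomputable def Lstar (L : (Idx m κ → ℝ) → (Idx m κ → ℝ) → ℝ → ℝ)
    (φ : Fin κ → (Fin m → ℝ) → (Idx m κ → ℝ) → ℝ → ℝ)
    (v : Fin m → ℝ) (x : Idx m κ → ℝ) (t : ℝ) : ℝ :=
  L (etaExt φ v x t) x t

/-- `∂L*/∂η_j`. -/
noncomputable def pLstar (L : (Idx m κ → ℝ) → (Idx m κ → ℝ) → ℝ → ℝ)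
    (φ : Fin κ → (Fin m → ℝ) → (Idx m κ → ℝ) → ℝ → ℝ)
    (j : Fin m) (v : Fin m → ℝ) (x : Idx m κ → ℝ) (t : ℝ) : ℝ :=
  pd (fun w => Lstar L φ w x t) j v

/-- `(A_j^α)*` along a motion `t ↦ (xc t)` with independent parameters `t ↦ vm t`. -/
noncomputable def Astar (ξ : Idx m κ → (Idx m κ → ℝ) → Idx m κ → ℝ)
    (C0 : Idx m κ → Idx m κ → (Idx m κ → ℝ) → ℝ → ℝ)
    (C : Idx m κ → Idx m κ → Idx m κ → (Idx m κ → ℝ) → ℝ → ℝ)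
    (φ : Fin κ → (Fin m → ℝ) → (Idx m κ → ℝ) → ℝ → ℝ)
    (xc : ℝ → Idx m κ → ℝ) (vm : ℝ → Fin m → ℝ)
    (j : Fin m) (α : Fin κ) (t : ℝ) : ℝ :=
  deriv (fun τ => dphi φ α j (vm τ) (xc τ) τ) t
    - Xstar ξ φ j (fun x' t' => φ α (vm t) x' t') (vm t) (xc t) t
    + K0 C0 φ j (.inr α) (vm t) (xc t) t
    + ∑ i, Kq C φ (.inl i) j (.inr α) (vm t) (xc t) t * vm t i
    + ∑ β, Kq C φ (.inr β) j (.inr α) (vm t) (xc t) t * φ β (vm t) (xc t) t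
    - ∑ k', (K0 C0 φ j (.inl k') (vm t) (xc t) t
        + ∑ i, Kq C φ (.inl i) j (.inl k') (vm t) (xc t) t * vm t i
        + ∑ β, Kq C φ (.inr β) j (.inl k') (vm t) (xc t) t * φ β (vm t) (xc t) t)
        * dphi φ α k' (vm t) (xc t) t

/-- Independent part of the Poincaré parameters of a motion. -/
noncomputable def vmOf (η : ℝ → Idx m κ → ℝ) (t : ℝ) : Fin m → ℝ := fun i => η t (.inl i)

/-- Left-hand side of the multiplier-free Poincaré equations of motion
`d/dt(∂L*/∂η_j) − (K_{0j}^k + K_{qj}^k η_q) ∂L*/∂η_k − X*_j L* − (A_j^α)* (∂L/∂η_α)*`. -/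
noncomputable def PoincareLHS (ξ : Idx m κ → (Idx m κ → ℝ) → Idx m κ → ℝ)
    (C0 : Idx m κ → Idx m κ → (Idx m κ → ℝ) → ℝ → ℝ)
    (C : Idx m κ → Idx m κ → Idx m κ → (Idx m κ → ℝ) → ℝ → ℝ)
    (φ : Fin κ → (Fin m → ℝ) → (Idx m κ → ℝ) → ℝ → ℝ)
    (L : (Idx m κ → ℝ) → (Idx m κ → ℝ) → ℝ → ℝ)
    (xc : ℝ → Idx m κ → ℝ) (η : ℝ → Idx m κ → ℝ)
    (j : Fin m) (t : ℝ) : ℝ :=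
  deriv (fun τ => pLstar L φ j (vmOf η τ) (xc τ) τ) t
    - ∑ k', (K0 C0 φ j (.inl k') (vmOf η t) (xc t) t
        + ∑ q, Kq C φ q j (.inl k') (vmOf η t) (xc t) t * η t q)
        * pLstar L φ k' (vmOf η t) (xc t) t
    - Xstar ξ φ j (fun x' t' => Lstar L φ (vmOf η t) x' t') (vmOf η t) (xc t) t
    - ∑ α, Astar ξ C0 C φ xc (vmOf η) j α t
        * pEta L (.inr α) (etaExt φ (vmOf η t) (xc t) t) (xc t) t

/-- The reduced Hamiltonian `H*(x, y*, t) := η_j y*_j − L*`, where `ηhat`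
inverts the Legendre transformation `y*_j = ∂L*/∂η_j`. -/
noncomputable def Hstar (L : (Idx m κ → ℝ) → (Idx m κ → ℝ) → ℝ → ℝ)
    (φ : Fin κ → (Fin m → ℝ) → (Idx m κ → ℝ) → ℝ → ℝ)
    (ηhat : (Idx m κ → ℝ) → (Fin m → ℝ) → ℝ → Fin m → ℝ)
    (x : Idx m κ → ℝ) (y : Fin m → ℝ) (t : ℝ) : ℝ :=
  (∑ j, ηhat x y t j * y j) - Lstar L φ (ηhat x y t) x t

section PartialDerivatives

variable {ι : Type*} [Fintype ι] [DecidableEq ι]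

lemma pd_eq_fderiv {f : (ι → ℝ) → ℝ} {v : ι → ℝ} (hf : DifferentiableAt ℝ f v) (i : ι) :
    pd f i v = fderiv ℝ f v (Pi.single i 1) := by
  have h1 : HasDerivAt (Function.update v i) (Pi.single i 1) (v i) := hasDerivAt_update v i (v i)
  have h2 : HasFDerivAt f (fderiv ℝ f v) (Function.update v i (v i)) := by
    simpa using hf.hasFDerivAt
  exact (h2.comp_hasDerivAt (v i) h1).deriv

lemma sum_mul_pd {f : (ι → ℝ) → ℝ} {v : ι → ℝ} (hf : DifferentiableAt ℝ f v) (a : ι → ℝ) :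
    ∑ i, a i * pd f i v = fderiv ℝ f v a := by
  conv_rhs => rw [pi_eq_sum_univ' a]
  simp [pd_eq_fderiv hf, Pi.single, map_sum]

end PartialDerivatives

/-- The coefficients of a `Cⁿ` vector in a `Cⁿ` moving frame are `Cⁿ`. -/
lemma contDiff_frame_coeff {ι Z : Type*} [Fintype ι] [DecidableEq ι] [NormedAddCommGroup Z]
    [NormedSpace ℝ Z] {n : WithTop ℕ∞} {b : ι → Z → ι → ℝ} {c : ι → Z → ℝ}
    (hb : ∀ q, ContDiff ℝ n (b q)) (hind : ∀ z, LinearIndependent ℝ fun q => b q z)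
    (hc : ContDiff ℝ n fun z => ∑ q, c q z • b q z) (q : ι) : ContDiff ℝ n (c q) := by
  let L : Z → (ι → ℝ) →L[ℝ] (ι → ℝ) := fun z =>
    ∑ q, (ContinuousLinearMap.proj (R := ℝ) (φ := fun _ : ι => ℝ) q).smulRight (b q z)
  have hLapp : ∀ z a, L z a = ∑ q, a q • b q z := fun z a => by simp [L]
  have hL : ContDiff ℝ n L := by
    refine ContDiff.sum fun q _ => ?_
    exact (ContinuousLinearMap.smulRightL ℝ (ι → ℝ) (ι → ℝ)
      (ContinuousLinearMap.proj (R := ℝ) (φ := fun _ : ι => ℝ) q)).contDiff.comp (hb q)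
  have hinj : ∀ z, Function.Injective (L z) := fun z => by
    refine (injective_iff_map_eq_zero (L z)).2 fun a ha => ?_
    rw [hLapp] at ha
    exact funext (Fintype.linearIndependent_iff.1 (hind z) a ha)
  let e : ∀ z, (ι → ℝ) ≃L[ℝ] (ι → ℝ) := fun z =>
    (LinearEquiv.ofInjectiveEndo (L z : (ι → ℝ) →ₗ[ℝ] (ι → ℝ)) (hinj z)).toContinuousLinearEquiv
  have he : ∀ z, (e z : (ι → ℝ) →L[ℝ] (ι → ℝ)) = L z := fun z => by
    ext; rfl
  have hinv : ContDiff ℝ n fun z => (L z).inverse := contDiff_iff_contDiffAt.2 fun z => by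
    have h := contDiffAt_map_inverse (𝕜 := ℝ) (n := n) (e z)
    rw [he] at h
    exact h.comp z hL.contDiffAt
  have hcz : (fun z => c q z) = fun z => (L z).inverse (∑ q, c q z • b q z) q := by
    funext z
    have : ∑ q, c q z • b q z = e z (fun q => c q z) := (hLapp z fun q => c q z).symm
    rw [this, ← he, ContinuousLinearMap.inverse_equiv]
    simp
  change ContDiff ℝ n fun z => c q z
  rw [hcz]
  exact contDiff_pi.1 (hinv.clm_apply hc) q

section Brackets

variable {m κ : ℕ} {ξ : Idx m κ → (Idx m κ → ℝ) → Idx m κ → ℝ}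
  {ξ0 : (Idx m κ → ℝ) → ℝ → Idx m κ → ℝ}

lemma Xp_eq_fderiv (p : Idx m κ) {G : (Idx m κ → ℝ) → ℝ → ℝ} {x : Idx m κ → ℝ} {t : ℝ}
    (hG : DifferentiableAt ℝ (fun v => G v t) x) :
    Xp ξ p G x t = fderiv ℝ (fun v => G v t) x (ξ p x) :=
  sum_mul_pd hG _

lemma fderiv_coord {E : Type*} [NormedAddCommGroup E] [NormedSpace ℝ E] {ι : Type*} [Fintype ι]
    {F : E → ι → ℝ} {x : E} (hF : DifferentiableAt ℝ F x) (k : ι) (a : E) :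
    fderiv ℝ (fun v => F v k) x a = fderiv ℝ F x a k := by
  rw [fderiv_apply hF]; rfl

lemma Xp_coord (p k : Idx m κ) : Xp ξ p (fun x _ => x k) = fun x _ => ξ p x k := by
  funext x t
  rw [Xp_eq_fderiv p (by fun_prop)]
  rw [fderiv_coord (F := fun v => v) differentiableAt_id]
  simp

lemma X0_coord (k : Idx m κ) : X0 ξ0 (fun x _ => x k) = fun x t => ξ0 x t k := by
  funext x t
  rw [X0, sum_mul_pd (by fun_prop)]
  rw [fderiv_coord (F := fun v => v) differentiableAt_id]
  simp

/-- The structure equations for `X_p`, read off on the coordinate functions. -/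
lemma lieBracket_eq {C : Idx m κ → Idx m κ → Idx m κ → (Idx m κ → ℝ) → ℝ → ℝ}
    (hξ : ∀ p, Differentiable ℝ (ξ p))
    (hcomm : ∀ p q (G : (Idx m κ → ℝ) → ℝ → ℝ),
      ContDiff ℝ 2 (fun z : (Idx m κ → ℝ) × ℝ => G z.1 z.2) →
      ∀ x t, Xp ξ p (Xp ξ q G) x t - Xp ξ q (Xp ξ p G) x t
        = ∑ r, C p q r x t * Xp ξ r G x t)
    (p q : Idx m κ) (x : Idx m κ → ℝ) (t : ℝ) :
    fderiv ℝ (ξ q) x (ξ p x) - fderiv ℝ (ξ p) x (ξ q x) = ∑ r, C p q r x t • ξ r x := by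
  funext k
  have h := hcomm p q (fun x _ => x k) (by fun_prop) x t
  have hd : ∀ r, DifferentiableAt ℝ (fun v => ξ r v k) x := fun r =>
    differentiableAt_pi.1 (hξ r x) k
  simp only [Xp_coord] at h
  rw [Xp_eq_fderiv p (hd q), Xp_eq_fderiv q (hd p), fderiv_coord (hξ q x),
    fderiv_coord (hξ p x)] at h
  simpa using h

/-- The structure equations for `X₀` and `X_p`, read off on the coordinate functions. -/
lemma lieBracket_zero_eq {C0 : Idx m κ → Idx m κ → (Idx m κ → ℝ) → ℝ → ℝ}
    (hξ : ∀ p, Differentiable ℝ (ξ p)) (hξ0 : ∀ t, Differentiable ℝ fun x => ξ0 x t)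
    (hcomm0 : ∀ p (G : (Idx m κ → ℝ) → ℝ → ℝ),
      ContDiff ℝ 2 (fun z : (Idx m κ → ℝ) × ℝ => G z.1 z.2) →
      ∀ x t, X0 ξ0 (Xp ξ p G) x t - Xp ξ p (X0 ξ0 G) x t
        = ∑ q, C0 p q x t * Xp ξ q G x t)
    (p : Idx m κ) (x : Idx m κ → ℝ) (t : ℝ) :
    fderiv ℝ (ξ p) x (ξ0 x t) - fderiv ℝ (fun y => ξ0 y t) x (ξ p x)
      = ∑ r, C0 p r x t • ξ r x := by
  funext k
  have h := hcomm0 p (fun x _ => x k) (by fun_prop) x t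
  simp only [Xp_coord, X0_coord] at h
  rw [X0, sum_mul_pd (differentiableAt_pi.1 (hξ p x) k),
    Xp_eq_fderiv p (differentiableAt_pi.1 (hξ0 t x) k), fderiv_coord (hξ p x),
    fderiv_coord (hξ0 t x)] at h
  simpa using h

end Brackets

section Family

variable {m κ : ℕ} {ξ : Idx m κ → (Idx m κ → ℝ) → Idx m κ → ℝ}
  {ξ0 : (Idx m κ → ℝ) → ℝ → Idx m κ → ℝ} {x : ℝ × ℝ → Idx m κ → ℝ}
  {η ω : Idx m κ → ℝ → ℝ → ℝ}

lemma hasDerivAt_slice_fst {E : Type*} [NormedAddCommGroup E] [NormedSpace ℝ E] {g : ℝ × ℝ → E}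
    {t ε : ℝ} (hg : DifferentiableAt ℝ g (t, ε)) :
    HasDerivAt (fun τ => g (τ, ε)) (fderiv ℝ g (t, ε) (1, 0)) t :=
  hg.hasFDerivAt.comp_hasDerivAt t ((hasDerivAt_id t).prodMk (hasDerivAt_const t ε))

lemma hasDerivAt_slice_snd {E : Type*} [NormedAddCommGroup E] [NormedSpace ℝ E] {g : ℝ × ℝ → E}
    {t ε : ℝ} (hg : DifferentiableAt ℝ g (t, ε)) :
    HasDerivAt (fun e => g (t, e)) (fderiv ℝ g (t, ε) (0, 1)) ε :=
  hg.hasFDerivAt.comp_hasDerivAt ε ((hasDerivAt_const ε t).prodMk (hasDerivAt_id ε))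

lemma fderiv_fst_eq (hx : Differentiable ℝ x)
    (hη : ∀ p t ε, deriv (fun τ => x (τ, ε) p) t
      = ξ0 (x (t, ε)) t p + ∑ q, η q t ε * ξ q (x (t, ε)) p) (z : ℝ × ℝ) :
    fderiv ℝ x z (1, 0) = ξ0 (x z) z.1 + ∑ q, η q z.1 z.2 • ξ q (x z) := by
  funext p
  have h := (hasDerivAt_pi.1 (hasDerivAt_slice_fst (hx (z.1, z.2))) p).deriv
  rw [hη] at h
  simpa using h.symm

lemma fderiv_snd_eq (hx : Differentiable ℝ x)
    (hω : ∀ p t ε, deriv (fun e => x (t, e) p) ε = ∑ q, ω q t ε * ξ q (x (t, ε)) p)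
    (z : ℝ × ℝ) :
    fderiv ℝ x z (0, 1) = ∑ q, ω q z.1 z.2 • ξ q (x z) := by
  funext p
  have h := (hasDerivAt_pi.1 (hasDerivAt_slice_snd (hx (z.1, z.2))) p).deriv
  rw [hω] at h
  simpa using h.symm

lemma contDiff_real_params (hξ : ∀ p, ContDiff ℝ 2 (ξ p))
    (hξ0 : ContDiff ℝ 2 (fun z : (Idx m κ → ℝ) × ℝ => ξ0 z.1 z.2))
    (hind : ∀ x : Idx m κ → ℝ, LinearIndependent ℝ fun p => ξ p x) (hx : ContDiff ℝ 2 x)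
    (hdt : ∀ z, fderiv ℝ x z (1, 0) = ξ0 (x z) z.1 + ∑ q, η q z.1 z.2 • ξ q (x z))
    (q : Idx m κ) : ContDiff ℝ 1 fun z : ℝ × ℝ => η q z.1 z.2 := by
  have hx1 : ContDiff ℝ 1 x := hx.of_le one_le_two
  refine contDiff_frame_coeff (b := fun q z => ξ q (x z)) (c := fun q z => η q z.1 z.2)
    (fun q => ((hξ q).of_le one_le_two).comp hx1) (fun z => hind (x z)) ?_ q
  have h : (fun z : ℝ × ℝ => ∑ q, η q z.1 z.2 • ξ q (x z))
      = fun z => fderiv ℝ x z (1, 0) - ξ0 (x z) z.1 := by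
    funext z; rw [hdt z]; abel
  rw [h]
  exact ((hx.fderiv_right (m := 1) (by norm_num)).clm_apply contDiff_const).sub
    ((hξ0.of_le one_le_two).comp (hx1.prodMk contDiff_fst))

lemma contDiff_virtual_params (hξ : ∀ p, ContDiff ℝ 2 (ξ p))
    (hind : ∀ x : Idx m κ → ℝ, LinearIndependent ℝ fun p => ξ p x) (hx : ContDiff ℝ 2 x)
    (hde : ∀ z, fderiv ℝ x z (0, 1) = ∑ q, ω q z.1 z.2 • ξ q (x z))
    (q : Idx m κ) : ContDiff ℝ 1 fun z : ℝ × ℝ => ω q z.1 z.2 := by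
  refine contDiff_frame_coeff (b := fun q z => ξ q (x z)) (c := fun q z => ω q z.1 z.2)
    (fun q => ((hξ q).comp hx).of_le one_le_two) (fun z => hind (x z)) ?_ q
  simp only [← hde]
  exact (hx.fderiv_right (m := 1) (by norm_num)).clm_apply contDiff_const

/-- The transpositional relations `∂_ε η_r = ∂_t ω_r + (C_{0p}^r + C_{qp}^r η_q) ω_p`. -/
lemma transposition {C0 : Idx m κ → Idx m κ → (Idx m κ → ℝ) → ℝ → ℝ}
    {C : Idx m κ → Idx m κ → Idx m κ → (Idx m κ → ℝ) → ℝ → ℝ}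
    (hξ : ∀ p, Differentiable ℝ (ξ p)) (hξ0 : ∀ t, Differentiable ℝ fun x => ξ0 x t)
    (hind : ∀ x : Idx m κ → ℝ, LinearIndependent ℝ fun p => ξ p x) (hx : ContDiff ℝ 2 x)
    (hη1 : ∀ q, Differentiable ℝ fun z : ℝ × ℝ => η q z.1 z.2)
    (hω1 : ∀ q, Differentiable ℝ fun z : ℝ × ℝ => ω q z.1 z.2)
    (hdt : ∀ z, fderiv ℝ x z (1, 0) = ξ0 (x z) z.1 + ∑ q, η q z.1 z.2 • ξ q (x z))
    (hde : ∀ z, fderiv ℝ x z (0, 1) = ∑ q, ω q z.1 z.2 • ξ q (x z))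
    (hbr0 : ∀ p x t, fderiv ℝ (ξ p) x (ξ0 x t) - fderiv ℝ (fun y => ξ0 y t) x (ξ p x)
      = ∑ r, C0 p r x t • ξ r x)
    (hbr : ∀ p q x t, fderiv ℝ (ξ q) x (ξ p x) - fderiv ℝ (ξ p) x (ξ q x)
      = ∑ r, C p q r x t • ξ r x)
    (t ε : ℝ) (r : Idx m κ) :
    deriv (fun e => η r t e) ε = deriv (fun τ => ω r τ ε) t
      + ∑ p, (C0 p r (x (t, ε)) t + ∑ q, C q p r (x (t, ε)) t * η q t ε) * ω p t ε := by
  have hxd : Differentiable ℝ x := hx.differentiable two_ne_zero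
  have hD : Differentiable ℝ (fderiv ℝ x) :=
    (hx.fderiv_right (m := 1) (by norm_num)).differentiable one_ne_zero
  have hsymm : fderiv ℝ (fun z => fderiv ℝ x z (1, 0)) (t, ε) (0, 1)
      = fderiv ℝ (fun z => fderiv ℝ x z (0, 1)) (t, ε) (1, 0) := by
    have h := (hx.contDiffAt (x := (t, ε))).isSymmSndFDerivAt (by simp)
    rw [fderiv_clm_apply (hD _) (by fun_prop), fderiv_clm_apply (hD _) (by fun_prop)]
    simpa using h (0, 1) (1, 0)
  have hηe : ∀ q, HasDerivAt (fun e => η q t e) (deriv (fun e => η q t e) ε) ε := fun q =>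
    (hasDerivAt_slice_snd (hη1 q (t, ε))).differentiableAt.hasDerivAt
  have hωt : ∀ q, HasDerivAt (fun τ => ω q τ ε) (deriv (fun τ => ω q τ ε) t) t := fun q =>
    (hasDerivAt_slice_fst (hω1 q (t, ε))).differentiableAt.hasDerivAt
  have hξe : ∀ q, HasDerivAt (fun e => ξ q (x (t, e)))
      (fderiv ℝ (ξ q) (x (t, ε)) (fderiv ℝ x (t, ε) (0, 1))) ε := fun q =>
    (hξ q _).hasFDerivAt.comp_hasDerivAt ε (hasDerivAt_slice_snd (hxd (t, ε)))
  have hξt : ∀ q, HasDerivAt (fun τ => ξ q (x (τ, ε)))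
      (fderiv ℝ (ξ q) (x (t, ε)) (fderiv ℝ x (t, ε) (1, 0))) t := fun q =>
    (hξ q _).hasFDerivAt.comp_hasDerivAt t (hasDerivAt_slice_fst (hxd (t, ε)))
  have hξ0e : HasDerivAt (fun e => ξ0 (x (t, e)) t)
      (fderiv ℝ (fun y => ξ0 y t) (x (t, ε)) (fderiv ℝ x (t, ε) (0, 1))) ε :=
    (hξ0 t _).hasFDerivAt.comp_hasDerivAt ε (hasDerivAt_slice_snd (hxd (t, ε)))
  have h1 := hasDerivAt_slice_snd (t := t) (ε := ε) (g := fun z => fderiv ℝ x z (1, 0))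
    (by fun_prop)
  have h2 := hasDerivAt_slice_fst (t := t) (ε := ε) (g := fun z => fderiv ℝ x z (0, 1))
    (by fun_prop)
  rw [hsymm] at h1
  simp only [hdt] at h1
  simp only [hde] at h1 h2
  have h1' := hξ0e.add (HasDerivAt.fun_sum fun q (_ : q ∈ Finset.univ) => (hηe q).smul (hξe q))
  have h2' := HasDerivAt.fun_sum fun q (_ : q ∈ Finset.univ) => (hωt q).smul (hξt q)
  have heq := (h1'.unique h1).trans (h2.unique h2')
  simp only [hdt, hde, map_sum, map_add, map_smul, Finset.sum_add_distrib, smul_add,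
    Finset.smul_sum] at heq
  set X := x (t, ε)
  have hzero : ∑ r, (deriv (fun e => η r t e) ε - (deriv (fun τ => ω r τ ε) t
      + ∑ p, (C0 p r X t + ∑ q, C q p r X t * η q t ε) * ω p t ε)) • ξ r X = 0 := by
    have hA : ∑ r, (∑ p, C0 p r X t * ω p t ε) • ξ r X
        = ∑ p, ω p t ε • (fderiv ℝ (ξ p) X (ξ0 X t) - fderiv ℝ (fun y => ξ0 y t) X (ξ p X)) := by
      simp only [hbr0, Finset.sum_smul, Finset.smul_sum, smul_smul]
      rw [Finset.sum_comm]
      simp only [mul_comm]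
    have hB : ∑ r, (∑ p, (∑ q, C q p r X t * η q t ε) * ω p t ε) • ξ r X
        = ∑ p, ∑ q, ω p t ε • η q t ε •
            (fderiv ℝ (ξ p) X (ξ q X) - fderiv ℝ (ξ q) X (ξ p X)) := by
      simp only [hbr _ _ X t, Finset.sum_smul, Finset.smul_sum, Finset.sum_mul, smul_smul]
      rw [Finset.sum_comm]
      refine Finset.sum_congr rfl fun p _ => ?_
      rw [Finset.sum_comm]
      refine Finset.sum_congr rfl fun q _ => Finset.sum_congr rfl fun r _ => ?_
      congr 1
      ring
    have hswap : ∑ q, ∑ p, η q t ε • ω p t ε • fderiv ℝ (ξ q) X (ξ p X)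
        = ∑ p, ∑ q, ω p t ε • η q t ε • fderiv ℝ (ξ q) X (ξ p X) := by
      rw [Finset.sum_comm]
      simp only [smul_comm (η _ t ε)]
    simp only [add_mul, Finset.sum_add_distrib, sub_smul, add_smul, Finset.sum_sub_distrib, hA, hB,
      smul_sub]
    rw [hswap] at heq
    linear_combination heq
  have := Fintype.linearIndependent_iff.1 (hind X) _ hzero r
  exact sub_eq_zero.1 this

end Family

/-- **synchronous variation of a function under the Chetaev
condition, eq. (3.5).** -/
theorem delta_f_formula {m κ : ℕ}
    (ξ : Idx m κ → (Idx m κ → ℝ) → Idx m κ → ℝ)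
    (ξ0 : (Idx m κ → ℝ) → ℝ → Idx m κ → ℝ)
    (C0 : Idx m κ → Idx m κ → (Idx m κ → ℝ) → ℝ → ℝ)
    (C : Idx m κ → Idx m κ → Idx m κ → (Idx m κ → ℝ) → ℝ → ℝ)
    (hξ : ∀ p, ContDiff ℝ 2 (ξ p))
    (hξ0 : ContDiff ℝ 2 (fun z : (Idx m κ → ℝ) × ℝ => ξ0 z.1 z.2))
    (hind : ∀ x : Idx m κ → ℝ, LinearIndependent ℝ fun p => ξ p x)
    (hcomm0 : ∀ p (G : (Idx m κ → ℝ) → ℝ → ℝ),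
      ContDiff ℝ 2 (fun z : (Idx m κ → ℝ) × ℝ => G z.1 z.2) →
      ∀ x t, X0 ξ0 (Xp ξ p G) x t - Xp ξ p (X0 ξ0 G) x t
        = ∑ q, C0 p q x t * Xp ξ q G x t)
    (hcomm : ∀ p q (G : (Idx m κ → ℝ) → ℝ → ℝ),
      ContDiff ℝ 2 (fun z : (Idx m κ → ℝ) × ℝ => G z.1 z.2) →
      ∀ x t, Xp ξ p (Xp ξ q G) x t - Xp ξ q (Xp ξ p G) x t
        = ∑ r, C p q r x t * Xp ξ r G x t)
    -- the C² two-parameter family and its Poincaré parameters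
    (x : ℝ × ℝ → Idx m κ → ℝ) (hx : ContDiff ℝ 2 x)
    (η ω : Idx m κ → ℝ → ℝ → ℝ)
    (hη : ∀ p t ε, deriv (fun τ => x (τ, ε) p) t
      = ξ0 (x (t, ε)) t p + ∑ q, η q t ε * ξ q (x (t, ε)) p)
    (hω : ∀ p t ε, deriv (fun e => x (t, e) p) ε
      = ∑ q, ω q t ε * ξ q (x (t, ε)) p)
    -- the C² function `f(η, x, t)`
    (f : (Idx m κ → ℝ) → (Idx m κ → ℝ) → ℝ → ℝ)
    (hf : ContDiff ℝ 2 (fun z : (Idx m κ → ℝ) × (Idx m κ → ℝ) × ℝ => f z.1 z.2.1 z.2.2))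
    -- the Chetaev condition `(∂f/∂η_p) ω_p = 0` along `ε = 0`
    (hchetaev : ∀ t,
      (∑ p, pEta f p (fun r => η r t 0) (x (t, 0)) t * ω p t 0) = 0) :
    ∀ t,
      deriv (fun e => f (fun p => η p t e) (x (t, e)) t) 0
        = ∑ p,
            (Xp ξ p (fun x' t' => f (fun r => η r t 0) x' t') (x (t, 0)) t
              + (∑ r, (C0 p r (x (t, 0)) t + ∑ q, C q p r (x (t, 0)) t * η q t 0)
                  * pEta f r (fun r' => η r' t 0) (x (t, 0)) t)
              - deriv (fun τ => pEta f p (fun r => η r τ 0) (x (τ, 0)) τ) t)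
            * ω p t 0 := by
  intro t
  have hξd : ∀ p, Differentiable ℝ (ξ p) := fun p => (hξ p).differentiable two_ne_zero
  have hξ0d : ∀ t, Differentiable ℝ fun x => ξ0 x t := fun t =>
    (hξ0.differentiable two_ne_zero).comp (differentiable_id.prodMk (differentiable_const t))
  have hxd : Differentiable ℝ x := hx.differentiable two_ne_zero
  have hdt := fderiv_fst_eq hxd hη
  have hde := fderiv_snd_eq hxd hω
  have hη1 : ∀ q, Differentiable ℝ fun z : ℝ × ℝ => η q z.1 z.2 := fun q =>
    (contDiff_real_params hξ hξ0 hind hx hdt q).differentiable one_ne_zero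
  have hω1 : ∀ q, Differentiable ℝ fun z : ℝ × ℝ => ω q z.1 z.2 := fun q =>
    (contDiff_virtual_params hξ hind hx hde q).differentiable one_ne_zero
  have htr := transposition hξd hξ0d hind hx hη1 hω1 hdt hde (lieBracket_zero_eq hξd hξ0d hcomm0)
    (lieBracket_eq hξd hcomm) t 0
  set F : (Idx m κ → ℝ) × (Idx m κ → ℝ) × ℝ → ℝ := fun z => f z.1 z.2.1 z.2.2
  have hFd : Differentiable ℝ F := hf.differentiable two_ne_zero
  have hDF : Differentiable ℝ (fderiv ℝ F) :=
    (hf.fderiv_right (m := 1) (by norm_num)).differentiable one_ne_zero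
  have hpartη : ∀ u v s, HasFDerivAt (fun w => f w v s)
      ((fderiv ℝ F (u, v, s)).comp (.inl ℝ _ _)) u := fun u v s =>
    HasFDerivAt.comp (g := F) (f := fun w => (w, v, s)) u (hFd (u, v, s)).hasFDerivAt
      (hasFDerivAt_prodMk_left u (v, s))
  have hpartx : ∀ u v s, HasFDerivAt (fun w => f u w s)
      ((fderiv ℝ F (u, v, s)).comp ((ContinuousLinearMap.inr ℝ _ _).comp (.inl ℝ _ _))) v :=
    fun u v s => HasFDerivAt.comp (g := F) (f := fun w => (u, w, s)) v (hFd (u, v, s)).hasFDerivAt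
      ((hasFDerivAt_prodMk_right u (v, s)).comp v (hasFDerivAt_prodMk_left v s))
  have hpEta : ∀ p u v s, pEta f p u v s = fderiv ℝ F (u, v, s) (Pi.single p 1, 0) := by
    intro p u v s
    rw [pEta, pd_eq_fderiv (hpartη u v s).differentiableAt, (hpartη u v s).fderiv]
    simp
  have hηe : HasDerivAt (fun e p => η p t e) (fun p => deriv (fun e => η p t e) 0) 0 :=
    hasDerivAt_pi.2 fun q =>
      (hasDerivAt_slice_snd (hη1 q (t, 0))).differentiableAt.hasDerivAt
  have hδ : deriv (fun e => f (fun p => η p t e) (x (t, e)) t) 0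
      = ∑ r, deriv (fun e => η r t e) 0 * pEta f r (fun r => η r t 0) (x (t, 0)) t
        + ∑ p, ω p t 0 * Xp ξ p (fun x' t' => f (fun r => η r t 0) x' t') (x (t, 0)) t := by
    have h := (hFd (fun p => η p t 0, x (t, 0), t)).hasFDerivAt.comp_hasDerivAt 0
      (hηe.prodMk ((hasDerivAt_slice_snd (hxd (t, 0))).prodMk (hasDerivAt_const 0 t)))
    refine h.deriv.trans ?_
    have h2 : ∀ p, Xp ξ p (fun x' t' => f (fun r => η r t 0) x' t') (x (t, 0)) t
        = fderiv ℝ F (fun r => η r t 0, x (t, 0), t) (0, ξ p (x (t, 0)), 0) := fun p => by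
      rw [Xp_eq_fderiv p (hpartx _ _ _).differentiableAt, (hpartx _ _ _).fderiv]
      simp
    have h3 : ∑ r, deriv (fun e => η r t e) 0 * pEta f r (fun r => η r t 0) (x (t, 0)) t
        = fderiv ℝ F (fun r => η r t 0, x (t, 0), t)
          (fun r => deriv (fun e => η r t e) 0, 0) := by
      simp only [pEta]
      rw [sum_mul_pd (hpartη _ _ _).differentiableAt (fun r => deriv (fun e => η r t e) 0),
        (hpartη _ _ _).fderiv]
      simp
    have h4 : ∑ p, ω p t 0 * fderiv ℝ F (fun r => η r t 0, x (t, 0), t) (0, ξ p (x (t, 0)), 0)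
        = fderiv ℝ F (fun r => η r t 0, x (t, 0), t) (0, ∑ p, ω p t 0 • ξ p (x (t, 0)), 0) := by
      have := map_sum ((fderiv ℝ F (fun r => η r t 0, x (t, 0), t)).comp
        ((ContinuousLinearMap.inr ℝ _ _).comp (.inl ℝ _ _)))
        (fun p => ω p t 0 • ξ p (x (t, 0))) Finset.univ
      simpa [-map_sum] using this.symm
    simp only [h2]
    rw [h3, h4, ← map_add, hde (t, 0)]
    simp
  have hchet : ∑ p, (deriv (fun τ => pEta f p (fun r => η r τ 0) (x (τ, 0)) τ) t * ω p t 0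
      + pEta f p (fun r => η r t 0) (x (t, 0)) t * deriv (fun τ => ω p τ 0) t) = 0 := by
    have hd : ∀ p, DifferentiableAt ℝ (fun τ => pEta f p (fun r => η r τ 0) (x (τ, 0)) τ) t := by
      intro p
      simp only [hpEta]
      have hηt : DifferentiableAt ℝ (fun τ r => η r τ 0) t := differentiableAt_pi.2 fun q =>
        (hasDerivAt_slice_fst (hη1 q (t, 0))).differentiableAt
      have hxt : DifferentiableAt ℝ (fun τ => x (τ, 0)) t :=
        (hasDerivAt_slice_fst (hxd (t, 0))).differentiableAt
      exact ((hDF _).comp t (hηt.prodMk (hxt.prodMk differentiableAt_id))).clm_apply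
        (differentiableAt_const _)
    have h := HasDerivAt.fun_sum fun p (_ : p ∈ Finset.univ) => (hd p).hasDerivAt.mul
      (hasDerivAt_slice_fst (hω1 p (t, 0))).differentiableAt.hasDerivAt
    refine h.unique ?_
    have h0 : (fun τ => ∑ p, pEta f p (fun r => η r τ 0) (x (τ, 0)) τ * ω p τ 0)
        = fun _ => 0 := funext hchetaev
    exact (hasDerivAt_const t (0 : ℝ)).congr_of_eventuallyEq (Filter.EventuallyEq.of_eq h0)
  rw [hδ]
  simp only [htr, add_mul, sub_mul, Finset.sum_add_distrib, Finset.sum_sub_distrib] at hchet ⊢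
  have hswap : ∀ A : Idx m κ → Idx m κ → ℝ,
      ∑ r, (∑ p, A p r * ω p t 0) * pEta f r (fun r => η r t 0) (x (t, 0)) t
        = ∑ p, (∑ r, A p r * pEta f r (fun r => η r t 0) (x (t, 0)) t) * ω p t 0 := fun A => by
    simp only [Finset.sum_mul]
    rw [Finset.sum_comm]
    exact Finset.sum_congr rfl fun _ _ => Finset.sum_congr rfl fun _ _ => mul_right_comm _ _ _
  rw [hswap, hswap]
  simp only [mul_comm (deriv (fun τ => ω _ τ 0) t), mul_comm (ω _ t 0) (Xp _ _ _ _ _)]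
  linear_combination hchet

end NNH
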